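/- Let G be the 12 × 12 real symmetric matrix with all diagonal entries equal to 1 and off-diagonal entries (symmetrically extended) G₁₂ = −1, G₁₃ = −3/2, G₂₄ = −3/2, G₃₄ = −1/2, G₃₅ = −1/2, G₅₆ = −1/2, G₆₇ = −1/2, G₇₈ = −1/2, G₈₉ = −1/2, G₈,₁₀ = −1/2, G₁₀,₁₁ = −1/2, G₁₁,₁₂ = −1/2, G₄,₁₂ = −1/2, and all other off-diagonal entries 0. Then G has exactly 9 positive eigenvalues (with multiplicity), exactly 1 negative eigenvalue, and exactly 2 zero eigenvalues; equivalently G has rank 10 and signature (9,1). -/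

import Mathlib

open Real

noncomputable def G18 : Matrix (Fin 12) (Fin 12) ℝ :=
  !![1, -1, -(3/2), 0, 0, 0, 0, 0, 0, 0, 0, 0;
     -1, 1, 0, -(3/2), 0, 0, 0, 0, 0, 0, 0, 0;
     -(3/2), 0, 1, -(1/2), -(1/2), 0, 0, 0, 0, 0, 0, 0;
     0, -(3/2), -(1/2), 1, 0, 0, 0, 0, 0, 0, 0, -(1/2);
     0, 0, -(1/2), 0, 1, -(1/2), 0, 0, 0, 0, 0, 0;
     0, 0, 0, 0, -(1/2), 1, -(1/2), 0, 0, 0, 0, 0;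
     0, 0, 0, 0, 0, -(1/2), 1, -(1/2), 0, 0, 0, 0;
     0, 0, 0, 0, 0, 0, -(1/2), 1, -(1/2), -(1/2), 0, 0;
     0, 0, 0, 0, 0, 0, 0, -(1/2), 1, 0, 0, 0;
     0, 0, 0, 0, 0, 0, 0, -(1/2), 0, 1, -(1/2), 0;
     0, 0, 0, 0, 0, 0, 0, 0, 0, -(1/2), 1, -(1/2);
     0, 0, 0, -(1/2), 0, 0, 0, 0, 0, 0, -(1/2), 1]

open Matrix QuadraticMap

/-- A real matrix congruent to a diagonal matrix represents, as a quadratic form, the weighted sum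
of squares of the diagonal entries. -/
theorem Matrix.toQuadraticForm'_equivalent_weightedSumSquares {n : Type*} [Fintype n]
    [DecidableEq n] {A P : Matrix n n ℝ} {w : n → ℝ} (hP : IsUnit P)
    (h : P * A * Pᵀ = diagonal w) :
    A.toQuadraticForm'.Equivalent (weightedSumSquares ℝ w) := by
  have hPt : IsUnit Pᵀ.det := by
    rw [det_transpose]
    exact (isUnit_iff_isUnit_det P).1 hP
  refine QuadraticMap.Equivalent.symm ⟨Matrix.toLinearEquiv' Pᵀ
    (Matrix.invertibleOfIsUnitDet _ hPt), fun x => ?_⟩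
  have hx : (Pᵀ *ᵥ x) ⬝ᵥ (A *ᵥ (Pᵀ *ᵥ x)) = x ⬝ᵥ (diagonal w *ᵥ x) := by
    simp only [← h, ← mulVec_mulVec, dotProduct_mulVec, mulVec_transpose]
  have hQ : A.toQuadraticForm' (Pᵀ *ᵥ x) = (Pᵀ *ᵥ x) ⬝ᵥ (A *ᵥ (Pᵀ *ᵥ x)) := by
    simp [Matrix.toQuadraticForm', Matrix.toLinearMap₂'_apply']
  refine (hQ.trans hx).trans ?_
  simp only [weightedSumSquares_apply, dotProduct, mulVec_diagonal, smul_eq_mul]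
  exact Finset.sum_congr rfl fun i _ => by ring

/-- The diagonal entries of a diagonal matrix congruent to `A` have the same number of positive
and of negative members as the eigenvalues of `A`. -/
theorem Matrix.IsHermitian.ncard_eigenvalues_of_congruent_diagonal {n : Type*} [Fintype n]
    [DecidableEq n] {A P : Matrix n n ℝ} {w : n → ℝ} (hA : A.IsHermitian) (hP : IsUnit P)
    (h : P * A * Pᵀ = diagonal w) :
    {i | 0 < hA.eigenvalues i}.ncard = {i | 0 < w i}.ncard ∧
      {i | hA.eigenvalues i < 0}.ncard = {i | w i < 0}.ncard := by
  have hw := toQuadraticForm'_equivalent_weightedSumSquares hP h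
  have he : A.toQuadraticForm'.Equivalent (weightedSumSquares ℝ hA.eigenvalues) := by
    refine toQuadraticForm'_equivalent_weightedSumSquares
      (P := (star hA.eigenvectorUnitary : Matrix n n ℝ)) ?_ ?_
    · exact (Unitary.toUnits (star hA.eigenvectorUnitary)).isUnit
    · have hd := hA.conjStarAlgAut_star_eigenvectorUnitary
      rw [Unitary.conjStarAlgAut_star_apply] at hd
      simpa [star_eq_conjTranspose, conjTranspose_eq_transpose_of_trivial,
        Function.comp_def] using hd
  exact ⟨(QuadraticForm.sigPos_of_equiv_weightedSumSquares he).symm.trans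
      (QuadraticForm.sigPos_of_equiv_weightedSumSquares hw),
    (QuadraticForm.sigNeg_of_equiv_weightedSumSquares he).symm.trans
      (QuadraticForm.sigNeg_of_equiv_weightedSumSquares hw)⟩

/-- The rational matrix whose real version is `G18`. -/
def gramRat : Matrix (Fin 12) (Fin 12) ℚ :=
  !![1, -1, -(3/2), 0, 0, 0, 0, 0, 0, 0, 0, 0;
     -1, 1, 0, -(3/2), 0, 0, 0, 0, 0, 0, 0, 0;
     -(3/2), 0, 1, -(1/2), -(1/2), 0, 0, 0, 0, 0, 0, 0;
     0, -(3/2), -(1/2), 1, 0, 0, 0, 0, 0, 0, 0, -(1/2);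
     0, 0, -(1/2), 0, 1, -(1/2), 0, 0, 0, 0, 0, 0;
     0, 0, 0, 0, -(1/2), 1, -(1/2), 0, 0, 0, 0, 0;
     0, 0, 0, 0, 0, -(1/2), 1, -(1/2), 0, 0, 0, 0;
     0, 0, 0, 0, 0, 0, -(1/2), 1, -(1/2), -(1/2), 0, 0;
     0, 0, 0, 0, 0, 0, 0, -(1/2), 1, 0, 0, 0;
     0, 0, 0, 0, 0, 0, 0, -(1/2), 0, 1, -(1/2), 0;
     0, 0, 0, 0, 0, 0, 0, 0, 0, -(1/2), 1, -(1/2);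
     0, 0, 0, -(1/2), 0, 0, 0, 0, 0, 0, -(1/2), 1]

/-- A change of basis diagonalizing `gramRat`. -/
def congrRat : Matrix (Fin 12) (Fin 12) ℚ :=
  !![1, 0, 6, 0, 9, 12, 15, 18, 9, 12, 6, 0;
     -1, 8, -6, 0, -9, -12, -15, -18, -9, -12, -6, 0;
     0, 0, 2, 0, 3, 4, 5, 6, 3, 4, 2, 0;
     -1, 2, -2, 2, -3, -4, -5, -6, -3, -4, -2, 0;
     0, 0, 0, 0, 5, 4, 3, 2, 1, 0, 0, 0;
     0, 0, 0, 0, 0, 4, 3, 2, 1, 0, 0, 0;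
     0, 0, 0, 0, 0, 0, 3, 2, 1, 0, 0, 0;
     0, 0, 0, 0, 0, 0, 0, 2, 1, 0, 0, 0;
     0, 0, 0, 0, 0, 0, 0, 0, 1, 0, 0, 0;
     0, 0, 0, 0, 1, 2, 3, 4, 2, 3, 0, 0;
     0, 0, 0, 0, 1, 2, 3, 4, 2, 3, 2, 0;
     -1, -1, 0, 0, 3, 6, 9, 12, 6, 9, 6, 3]

/-- The inverse of `congrRat`. -/
def congrInvRat : Matrix (Fin 12) (Fin 12) ℚ :=
  !![1, 0, -3, 0, 0, 0, 0, 0, 0, 0, 0, 0;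
     (1/8), (1/8), 0, 0, 0, 0, 0, 0, 0, 0, 0, 0;
     0, 0, (1/2), 0, -(1/6), 0, 0, 0, 0, -(1/6), -(1/2), 0;
     (3/8), -(1/8), -1, (1/2), 0, 0, 0, 0, 0, 0, 0, 0;
     0, 0, 0, 0, (1/5), -(1/5), 0, 0, 0, 0, 0, 0;
     0, 0, 0, 0, 0, (1/4), -(1/4), 0, 0, 0, 0, 0;
     0, 0, 0, 0, 0, 0, (1/3), -(1/3), 0, 0, 0, 0;
     0, 0, 0, 0, 0, 0, 0, (1/2), -(1/2), 0, 0, 0;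
     0, 0, 0, 0, 0, 0, 0, 0, 1, 0, 0, 0;
     0, 0, 0, 0, -(1/15), -(1/10), -(1/6), -(1/3), 0, (1/3), 0, 0;
     0, 0, 0, 0, 0, 0, 0, 0, 0, -(1/2), (1/2), 0;
     (3/8), (1/24), -1, 0, 0, 0, 0, 0, 0, 0, -1, (1/3)]

/-- The diagonal entries of the diagonalization of `gramRat`. -/
def diagRat : Fin 12 → ℚ :=
  ![-8, 72, 1, 0, 15, 10, 6, 3, 1, 3, 1, 0]

theorem congrRat_mul_congrInvRat : congrRat * congrInvRat = 1 := by
  decide +kernel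

theorem congrRat_mul_gramRat_mul_transpose :
    congrRat * gramRat * congrRatᵀ = diagonal diagRat := by
  decide +kernel

theorem map_gramRat : gramRat.map (Rat.castHom ℝ) = G18 := by
  ext i j
  fin_cases i <;> fin_cases j <;> simp [gramRat, G18]

theorem isUnit_map_congrRat : IsUnit (congrRat.map (Rat.castHom ℝ)) := by
  refine IsUnit.of_mul_eq_one (congrInvRat.map (Rat.castHom ℝ)) ?_
  rw [← Matrix.map_mul, congrRat_mul_congrInvRat]
  simp

theorem map_congrRat_mul_G18_mul_transpose :
    congrRat.map (Rat.castHom ℝ) * G18 * (congrRat.map (Rat.castHom ℝ))ᵀ =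
      diagonal fun i => (diagRat i : ℝ) := by
  rw [← map_gramRat, ← Matrix.transpose_map, ← Matrix.map_mul, ← Matrix.map_mul,
    congrRat_mul_gramRat_mul_transpose, Matrix.diagonal_map (map_zero _)]
  rfl

theorem stmt_18 (hG : G18.IsHermitian) :
    (Finset.univ.filter fun j => 0 < hG.eigenvalues j).card = 9 ∧
    (Finset.univ.filter fun j => hG.eigenvalues j < 0).card = 1 ∧
    (Finset.univ.filter fun j => hG.eigenvalues j = 0).card = 2 ∧
    G18.rank = 10 := by
  obtain ⟨hp, hn⟩ := hG.ncard_eigenvalues_of_congruent_diagonal isUnit_map_congrRat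
    map_congrRat_mul_G18_mul_transpose
  have hr : G18.rank = 10 := by
    rw [← Matrix.rank_mul_eq_right_of_isUnit_det _ G18
      ((isUnit_iff_isUnit_det _).1 isUnit_map_congrRat),
      ← Matrix.rank_mul_eq_left_of_isUnit_det (congrRat.map (Rat.castHom ℝ))ᵀ _ (by
        rw [det_transpose]
        exact (isUnit_iff_isUnit_det _).1 isUnit_map_congrRat),
      map_congrRat_mul_G18_mul_transpose, rank_diagonal, Fintype.card_subtype]
    simp only [ne_eq, Rat.cast_eq_zero]
    decide +kernel
  simp only [Rat.cast_pos, Rat.cast_lt_zero, Set.ncard_eq_toFinset_card',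
    Set.toFinset_ofPred] at hp hn
  refine ⟨hp.trans (by decide +kernel), hn.trans (by decide +kernel), ?_, hr⟩
  have hz := Finset.card_filter_add_card_filter_not (s := Finset.univ)
    fun j => hG.eigenvalues j = 0
  rw [hG.rank_eq_card_non_zero_eigs, Fintype.card_subtype] at hr
  simp only [ne_eq] at hr
  rw [hr, Finset.card_univ, Fintype.card_fin] at hz
  omega
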